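/- arXiv:1812.06324 — 2 statements merged into one kernel-verified Lean document; each statement's English description precedes it below -/
import Mathlib

section
/- Let n be a positive odd integer. Then sum_{k=0}^{n-1} [4k+1] * (q;q^2)_k^6/(q^2;q^2)_k^6 * q^k ≡ 0 (mod [n]), where [m] denotes the q-integer (1-q^m)/(1-q); that is, the numerator of the reduced form of this rational function in q is divisible by [n] in Z[q]. -/
open Finset Polynomial

/-- The `q`-shifted factorial `(a;q)_k`. -/
noncomputable def qp {F : Type*} [Field F] (a q : F) (k : ℕ) : F :=
  ∏ j ∈ Finset.range k, (1 - a * q ^ j)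

/-- The `q`-integer `[m]` as a rational function. -/
noncomputable def qint (m : ℕ) : RatFunc ℚ :=
  ∑ i ∈ Finset.range m, RatFunc.X ^ i

/-- The `q`-integer `[m]` as a polynomial. -/
noncomputable def qnat (m : ℕ) : Polynomial ℚ :=
  ∑ i ∈ Finset.range m, Polynomial.X ^ i

/-- The `q`-binomial coefficient as a rational function. -/
noncomputable def qbin (n k : ℕ) : RatFunc ℚ :=
  qp RatFunc.X RatFunc.X n / (qp RatFunc.X RatFunc.X k * qp RatFunc.X RatFunc.X (n - k))

/-- The rational function `f` is regular at `z`, with value `v` there. -/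
def HasValueAt (z : ℂ) (f : RatFunc ℚ) (v : ℂ) : Prop :=
  ∃ p s : ℚ[X], aeval z s ≠ 0 ∧
    f * algebraMap ℚ[X] (RatFunc ℚ) s = algebraMap ℚ[X] (RatFunc ℚ) p ∧
    aeval z p = v * aeval z s

namespace HasValueAt

variable {z v w : ℂ} {f g : RatFunc ℚ}

theorem of_polynomial (z : ℂ) (p : ℚ[X]) :
    HasValueAt z (algebraMap ℚ[X] (RatFunc ℚ) p) (aeval z p) :=
  ⟨p, 1, by simp, by simp, by simp⟩

theorem one (z : ℂ) : HasValueAt z 1 1 := by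
  simpa using of_polynomial z 1

theorem zero (z : ℂ) : HasValueAt z 0 0 := by
  simpa using of_polynomial z 0

theorem X_pow (z : ℂ) (k : ℕ) : HasValueAt z (RatFunc.X ^ k) (z ^ k) := by
  simpa using of_polynomial z (Polynomial.X ^ k)

theorem one_sub_X_pow (z : ℂ) (k : ℕ) :
    HasValueAt z (1 - RatFunc.X ^ k) (1 - z ^ k) := by
  have h := of_polynomial z (1 - Polynomial.X ^ k)
  rwa [map_sub, map_sub, map_one, map_one, map_pow, map_pow, RatFunc.algebraMap_X, aeval_X] at h

theorem add (hf : HasValueAt z f v) (hg : HasValueAt z g w) :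
    HasValueAt z (f + g) (v + w) := by
  obtain ⟨p, s, hs, hfs, hp⟩ := hf
  obtain ⟨p', s', hs', hgs, hp'⟩ := hg
  refine ⟨p * s' + p' * s, s * s', ?_, ?_, ?_⟩
  · simpa using ⟨hs, hs'⟩
  · simp only [map_add, map_mul, ← hfs, ← hgs]; ring
  · simp only [map_add, map_mul, hp, hp']; ring

theorem mul (hf : HasValueAt z f v) (hg : HasValueAt z g w) :
    HasValueAt z (f * g) (v * w) := by
  obtain ⟨p, s, hs, hfs, hp⟩ := hf
  obtain ⟨p', s', hs', hgs, hp'⟩ := hg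
  refine ⟨p * p', s * s', ?_, ?_, ?_⟩
  · simpa using ⟨hs, hs'⟩
  · simp only [map_mul, ← hfs, ← hgs]; ring
  · simp only [map_mul, hp, hp']; ring

theorem inv (hf : HasValueAt z f v) (hv : v ≠ 0) : HasValueAt z f⁻¹ v⁻¹ := by
  obtain ⟨p, s, hs, hfs, hp⟩ := hf
  have hp0 : aeval z p ≠ 0 := by rw [hp]; exact mul_ne_zero hv hs
  have hf0 : f ≠ 0 := by
    rintro rfl
    rw [zero_mul, eq_comm, FaithfulSMul.algebraMap_eq_zero_iff] at hfs
    simp [hfs] at hp0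
  refine ⟨s, p, hp0, ?_, ?_⟩
  · rw [← hfs, inv_mul_cancel_left₀ hf0]
  · rw [hp, inv_mul_cancel_left₀ hv]

theorem div (hf : HasValueAt z f v) (hg : HasValueAt z g w) (hw : w ≠ 0) :
    HasValueAt z (f / g) (v / w) := by
  simpa only [div_eq_mul_inv] using hf.mul (hg.inv hw)

theorem pow (hf : HasValueAt z f v) (k : ℕ) : HasValueAt z (f ^ k) (v ^ k) := by
  induction k with
  | zero => simpa using one z
  | succ k ih => simpa only [pow_succ] using ih.mul hf

theorem sum {ι : Type*} {t : Finset ι} {F : ι → RatFunc ℚ} {V : ι → ℂ}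
    (h : ∀ i ∈ t, HasValueAt z (F i) (V i)) :
    HasValueAt z (∑ i ∈ t, F i) (∑ i ∈ t, V i) := by
  classical
  induction t using Finset.induction_on with
  | empty => simpa using zero z
  | insert a t ha ih =>
    rw [sum_insert ha, sum_insert ha]
    exact (h a (mem_insert_self a t)).add (ih fun i hi => h i (mem_insert_of_mem hi))

theorem prod {ι : Type*} {t : Finset ι} {F : ι → RatFunc ℚ} {V : ι → ℂ}
    (h : ∀ i ∈ t, HasValueAt z (F i) (V i)) :
    HasValueAt z (∏ i ∈ t, F i) (∏ i ∈ t, V i) := by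
  classical
  induction t using Finset.induction_on with
  | empty => simpa using one z
  | insert a t ha ih =>
    rw [prod_insert ha, prod_insert ha]
    exact (h a (mem_insert_self a t)).mul (ih fun i hi => h i (mem_insert_of_mem hi))

theorem aeval_num_eq_zero (hf : HasValueAt z f 0) : aeval z f.num = 0 := by
  obtain ⟨p, s, hs, hfs, hp⟩ := hf
  have key : f.num * s = p * f.denom := by
    apply RatFunc.algebraMap_injective ℚ
    have hd : algebraMap ℚ[X] (RatFunc ℚ) f.denom ≠ 0 :=
      RatFunc.algebraMap_ne_zero f.denom_ne_zero
    have hnum : algebraMap ℚ[X] (RatFunc ℚ) f.num = f * algebraMap ℚ[X] (RatFunc ℚ) f.denom :=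
      (div_eq_iff hd).1 f.num_div_denom
    rw [map_mul, map_mul, ← hfs, hnum]
    ring
  have := congrArg (aeval z) key
  simpa [hp, hs] using this

end HasValueAt

section RootOfUnity

/-- The value `(z;z²)_k / (z²;z²)_k`. -/
noncomputable def halfRatio {F : Type*} [Field F] (z : F) (k : ℕ) : F :=
  ∏ j ∈ range k, (1 - z ^ (2 * j + 1)) / (1 - z ^ (2 * j + 2))

theorem halfRatio_succ {F : Type*} [Field F] (z : F) (k : ℕ) :
    halfRatio z (k + 1) =
      halfRatio z k * ((1 - z ^ (2 * k + 1)) / (1 - z ^ (2 * k + 2))) :=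
  prod_range_succ _ _

theorem qp_div_qp_eq_halfRatio {F : Type*} [Field F] (z : F) (k : ℕ) :
    qp z (z ^ 2) k / qp (z ^ 2) (z ^ 2) k = halfRatio z k := by
  simp only [qp, halfRatio, ← prod_div_distrib]
  refine prod_congr rfl fun j _ => ?_
  congr 2 <;> ring

variable {z : ℂ} {m : ℕ}

theorem one_sub_pow_ne_zero (hz : IsPrimitiveRoot z (2 * m + 1)) {k : ℕ}
    (hk : ¬ (2 * m + 1) ∣ k) : 1 - z ^ k ≠ 0 := fun h =>
  hk (hz.dvd_of_pow_eq_one k (sub_eq_zero.1 h).symm)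

theorem not_dvd_even {a r : ℕ} (hr : r < 2 * m) :
    ¬ (2 * m + 1) ∣ 2 * (a * (2 * m + 1) + r) + 2 := by
  intro h
  have h1 : (2 * m + 1) ∣ 2 * (r + 1) := by
    have h2 : 2 * (a * (2 * m + 1) + r) + 2 = (2 * m + 1) * (2 * a) + 2 * (r + 1) := by ring
    rwa [h2, Nat.dvd_add_right (dvd_mul_right _ _)] at h
  have hc : Nat.Coprime (2 * m + 1) 2 := by simp
  have := Nat.le_of_dvd (by omega) (hc.dvd_of_dvd_mul_left h1)
  omega

theorem pow_mul_order_add (hz : z ^ (2 * m + 1) = 1) (b r : ℕ) :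
    z ^ ((2 * m + 1) * b + r) = z ^ r := by
  rw [pow_add, pow_mul, hz, one_pow, one_mul]

theorem halfRatio_reflect (hz : IsPrimitiveRoot z (2 * m + 1)) {k : ℕ} (hk : k ≤ m) :
    halfRatio z (m - k) = z ^ k * halfRatio z k * halfRatio z m := by
  induction k with
  | zero => simp [halfRatio]
  | succ k ih =>
    have ih := ih (by omega)
    obtain ⟨l, rfl⟩ : ∃ l, m = k + 1 + l := ⟨m - (k + 1), by omega⟩
    rw [show k + 1 + l - k = l + 1 by omega, halfRatio_succ] at ih
    rw [show k + 1 + l - (k + 1) = l by omega, halfRatio_succ]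
    have h1 : 1 - z ^ (2 * k + 1) ≠ 0 :=
      one_sub_pow_ne_zero hz fun h => by have := Nat.le_of_dvd (by omega) h; omega
    have h2 : 1 - z ^ (2 * k + 2) ≠ 0 :=
      one_sub_pow_ne_zero hz fun h => by have := Nat.le_of_dvd (by omega) h; omega
    have h3 : 1 - z ^ (2 * l + 1) ≠ 0 :=
      one_sub_pow_ne_zero hz fun h => by have := Nat.le_of_dvd (by omega) h; omega
    have h4 : 1 - z ^ (2 * l + 2) ≠ 0 :=
      one_sub_pow_ne_zero hz fun h => by have := Nat.le_of_dvd (by omega) h; omega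
    have e1 : z ^ (2 * k + 1) * z ^ (2 * l + 2) = 1 := by
      rw [← pow_add, ← hz.pow_eq_one]; congr 1; ring
    have e2 : z ^ (2 * k + 2) * z ^ (2 * l + 1) = 1 := by
      rw [← pow_add, ← hz.pow_eq_one]; congr 1; ring
    have hfac : (1 - z ^ (2 * l + 1)) * z * (1 - z ^ (2 * k + 1)) =
        (1 - z ^ (2 * k + 2)) * (1 - z ^ (2 * l + 2)) := by
      have : z * z ^ (2 * k + 1) = z ^ (2 * k + 2) := by ring
      have : z * z ^ (2 * l + 1) = z ^ (2 * l + 2) := by ring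
      grind
    rw [← mul_div_assoc, div_eq_iff h4] at ih
    apply mul_right_cancel₀ h3
    rw [ih]
    field_simp
    linear_combination (- z ^ k * halfRatio z k * halfRatio z (k + 1 + l)) * hfac

/-- The value at a root of unity of the `k`-th summand. -/
noncomputable def summandValue (z : ℂ) (k : ℕ) : ℂ :=
  (z ^ (4 * k + 1) - 1) / (z - 1) * halfRatio z k ^ 6 * z ^ k

theorem summandValue_reflect (hz : IsPrimitiveRoot z (2 * m + 1)) {k : ℕ} (hk : k ≤ m) :
    summandValue z (m - k) = - summandValue z k := by
  have hz0 : z ≠ 0 := hz.ne_zero (by omega)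
  have hW : z ^ m * halfRatio z m ^ 2 = 1 := by
    have := halfRatio_reflect hz le_rfl
    rw [Nat.sub_self] at this
    rw [show halfRatio z 0 = 1 by simp [halfRatio]] at this
    rw [this]; ring
  rw [summandValue, summandValue, halfRatio_reflect hz hk]
  obtain ⟨l, rfl⟩ : ∃ l, m = k + l := ⟨m - k, by omega⟩
  rw [show k + l - k = l by omega]
  have h1 : (z ^ k) ^ 2 * (z ^ l) ^ 2 * z = 1 := by
    rw [← hz.pow_eq_one]; ring
  have e (j : ℕ) : z ^ (4 * j + 1) = (z ^ j) ^ 4 * z := by ring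
  rw [pow_add] at hW
  rw [e, e]
  have hy : z ^ k ≠ 0 := pow_ne_zero _ hz0
  have hx : z ^ l ≠ 0 := pow_ne_zero _ hz0
  generalize z ^ k = y at *
  generalize z ^ l = x at *
  generalize halfRatio z k = w at *
  generalize halfRatio z (k + l) = W at *
  have hW3 : y ^ 3 * x ^ 3 * W ^ 6 = 1 := by
    linear_combination (y ^ 2 * x ^ 2 * W ^ 4 + y * x * W ^ 2 + 1) * hW
  have key : (x ^ 4 * z - 1) * y ^ 6 * W ^ 6 * x = - ((y ^ 4 * z - 1) * y) := by
    apply mul_left_cancel₀ (mul_ne_zero (pow_ne_zero 3 hy) (pow_ne_zero 3 hx))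
    linear_combination ((x ^ 4 * z - 1) * y ^ 6 * x) * hW3 + (x ^ 3 * y ^ 4 + y ^ 6 * x) * h1
  linear_combination (w ^ 6 / (z - 1)) * key

theorem sum_summandValue (hz : IsPrimitiveRoot z (2 * m + 1)) :
    ∑ k ∈ range (2 * m + 1), summandValue z k = 0 := by
  have htail : ∀ i, summandValue z (m + 1 + i) = 0 := by
    intro i
    have : halfRatio z (m + 1 + i) = 0 := by
      refine prod_eq_zero (mem_range.2 (show m < m + 1 + i by omega)) ?_
      rw [hz.pow_eq_one, sub_self, zero_div]
    simp [summandValue, this]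
  rw [show 2 * m + 1 = m + 1 + m by ring, sum_range_add]
  simp only [htail, sum_const_zero, add_zero]
  have hrefl := sum_range_reflect (summandValue z) (m + 1)
  have hneg : ∑ j ∈ range (m + 1), summandValue z (m + 1 - 1 - j) =
      - ∑ j ∈ range (m + 1), summandValue z j := by
    rw [← sum_neg_distrib]
    refine sum_congr rfl fun j hj => ?_
    have hj := mem_range.1 hj
    exact summandValue_reflect hz (by omega)
  rw [hneg] at hrefl
  exact self_eq_neg.1 hrefl.symm

theorem HasValueAt.halfRatio_add (hz : IsPrimitiveRoot z (2 * m + 1)) {a : ℕ} {A : ℂ}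
    (hA : HasValueAt z (halfRatio RatFunc.X (a * (2 * m + 1))) A) {r : ℕ} (hr : r ≤ 2 * m) :
    HasValueAt z (halfRatio RatFunc.X (a * (2 * m + 1) + r)) (A * halfRatio z r) := by
  induction r with
  | zero => simpa [halfRatio] using hA
  | succ r ih =>
    rw [← add_assoc, halfRatio_succ, halfRatio_succ, ← mul_assoc]
    refine (ih (by omega)).mul ?_
    have h1 := one_sub_X_pow z (2 * (a * (2 * m + 1) + r) + 1)
    have h2 := one_sub_X_pow z (2 * (a * (2 * m + 1) + r) + 2)
    have e1 : z ^ (2 * (a * (2 * m + 1) + r) + 1) = z ^ (2 * r + 1) := by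
      rw [← pow_mul_order_add hz.pow_eq_one (2 * a) (2 * r + 1)]; ring
    have e2 : z ^ (2 * (a * (2 * m + 1) + r) + 2) = z ^ (2 * r + 2) := by
      rw [← pow_mul_order_add hz.pow_eq_one (2 * a) (2 * r + 2)]; ring
    rw [← e1, ← e2]
    exact h1.div h2 (one_sub_pow_ne_zero hz (not_dvd_even (by omega)))

theorem one_sub_X_pow_ne_zero {k : ℕ} (hk : k ≠ 0) : (1 - RatFunc.X ^ k : RatFunc ℚ) ≠ 0 := by
  intro h0
  have h1 : aeval (0 : ℂ) (1 - Polynomial.X ^ k : ℚ[X]) = 0 := by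
    have : algebraMap ℚ[X] (RatFunc ℚ) (1 - Polynomial.X ^ k) = 0 := by simpa using h0
    rw [(FaithfulSMul.algebraMap_eq_zero_iff _ _).1 this, map_zero]
  simp [hk] at h1

/-- At a `d`-th root of unity, `(1 - q^(db)) / (1 - q^(dc))` has the value `b / c`. -/
theorem HasValueAt.one_sub_div_one_sub {d : ℕ} (hd : d ≠ 0) (hz : z ^ d = 1) (b : ℕ) {c : ℕ}
    (hc : c ≠ 0) :
    HasValueAt z ((1 - RatFunc.X ^ (d * b)) / (1 - RatFunc.X ^ (d * c))) (b / c) := by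
  have hgeom (N : ℕ) : HasValueAt z (∑ i ∈ range N, RatFunc.X ^ (d * i)) N := by
    simpa [pow_mul, hz] using HasValueAt.sum fun i (_ : i ∈ range N) => X_pow z (d * i)
  have hfac (N : ℕ) : (1 - RatFunc.X ^ (d * N) : RatFunc ℚ) =
      (1 - RatFunc.X ^ d) * ∑ i ∈ range N, RatFunc.X ^ (d * i) := by
    simp only [pow_mul]
    exact (mul_neg_geom_sum _ _).symm
  rw [hfac, hfac, mul_div_mul_left _ _ (one_sub_X_pow_ne_zero hd)]
  exact (hgeom b).div (hgeom c) (Nat.cast_ne_zero.2 hc)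

theorem exists_hasValueAt_halfRatio (hz : IsPrimitiveRoot z (2 * m + 1)) (a : ℕ) :
    ∃ A, HasValueAt z (halfRatio RatFunc.X (a * (2 * m + 1))) A := by
  induction a with
  | zero => exact ⟨1, by simpa [halfRatio] using HasValueAt.one z⟩
  | succ a ih =>
    obtain ⟨A, hA⟩ := ih
    have hblock : halfRatio (RatFunc.X : RatFunc ℚ) ((a + 1) * (2 * m + 1)) =
        halfRatio RatFunc.X (a * (2 * m + 1)) *
        ((∏ j ∈ (range (2 * m + 1)).erase m,
            (1 - RatFunc.X ^ (2 * (a * (2 * m + 1) + j) + 1))) /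
          (∏ j ∈ range (2 * m), (1 - RatFunc.X ^ (2 * (a * (2 * m + 1) + j) + 2)))) *
        ((1 - RatFunc.X ^ ((2 * m + 1) * (2 * a + 1))) /
          (1 - RatFunc.X ^ ((2 * m + 1) * (2 * a + 2)))) := by
      rw [halfRatio, add_mul, one_mul, prod_range_add, ← halfRatio, prod_div_distrib,
        ← mul_prod_erase (range (2 * m + 1)) _ (mem_range.2 (show m < 2 * m + 1 by omega)),
        prod_range_succ,
        show 2 * (a * (2 * m + 1) + m) + 1 = (2 * m + 1) * (2 * a + 1) by ring,
        show 2 * (a * (2 * m + 1) + 2 * m) + 2 = (2 * m + 1) * (2 * a + 2) by ring,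
        mul_comm (1 - RatFunc.X ^ ((2 * m + 1) * (2 * a + 1))), mul_div_mul_comm, ← mul_assoc]
    rw [hblock]
    refine ⟨_, (hA.mul (HasValueAt.div
      (HasValueAt.prod fun j _ => HasValueAt.one_sub_X_pow z _)
      (HasValueAt.prod fun j _ => HasValueAt.one_sub_X_pow z _) ?_)).mul
      (HasValueAt.one_sub_div_one_sub (by omega) hz.pow_eq_one _ (by omega))⟩
    exact prod_ne_zero_iff.2 fun j hj =>
      one_sub_pow_ne_zero hz (not_dvd_even (mem_range.1 hj))

theorem hasValueAt_sum_zero (hm : 0 < m) (hz : IsPrimitiveRoot z (2 * m + 1)) (e : ℕ) :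
    HasValueAt z (∑ k ∈ range (e * (2 * m + 1)),
      qint (4 * k + 1) * (qp RatFunc.X (RatFunc.X ^ 2) k) ^ 6 /
        (qp (RatFunc.X ^ 2) (RatFunc.X ^ 2) k) ^ 6 * RatFunc.X ^ k) 0 := by
  have hterm (k : ℕ) : qint (4 * k + 1) * (qp RatFunc.X (RatFunc.X ^ 2) k) ^ 6 /
        (qp (RatFunc.X ^ 2) (RatFunc.X ^ 2) k) ^ 6 * RatFunc.X ^ k =
      qint (4 * k + 1) * halfRatio RatFunc.X k ^ 6 * RatFunc.X ^ k := by
    rw [← qp_div_qp_eq_halfRatio, div_pow, mul_div_assoc]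
  simp only [hterm]
  induction e with
  | zero => simpa using HasValueAt.zero z
  | succ e ih =>
    obtain ⟨A, hA⟩ := exists_hasValueAt_halfRatio hz e
    rw [add_mul, one_mul, sum_range_add]
    rw [← add_zero (0 : ℂ)]
    refine ih.add ?_
    rw [← mul_zero (A ^ 6), ← sum_summandValue hz, mul_sum]
    refine HasValueAt.sum fun r hr => ?_
    have hr := mem_range.1 hr
    have e1 : z ^ (4 * (e * (2 * m + 1) + r) + 1) = z ^ (4 * r + 1) := by
      rw [← pow_mul_order_add hz.pow_eq_one (4 * e) (4 * r + 1)]; ring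
    have hq : HasValueAt z (qint (4 * (e * (2 * m + 1) + r) + 1))
        ((z ^ (4 * r + 1) - 1) / (z - 1)) := by
      have := HasValueAt.sum fun i (_ : i ∈ range (4 * (e * (2 * m + 1) + r) + 1)) =>
        HasValueAt.X_pow z i
      rwa [geom_sum_eq (hz.ne_one (by omega)), e1] at this
    have hX : HasValueAt z (RatFunc.X ^ (e * (2 * m + 1) + r)) (z ^ r) := by
      have := HasValueAt.X_pow z (e * (2 * m + 1) + r)
      rwa [mul_comm e, pow_mul_order_add hz.pow_eq_one, mul_comm _ e] at this
    have := (hq.mul ((hA.halfRatio_add hz (r := r) (by omega)).pow 6)).mul hX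
    convert this using 1
    rw [summandValue]
    ring

end RootOfUnity

/-- `∑_{k=0}^{n-1} [4k+1] (q;q^2)_k^6/(q^2;q^2)_k^6 q^k ≡ 0 (mod [n])`. -/
theorem stmt4 (n : ℕ) (hn : 0 < n) (hodd : Odd n) :
    qnat n ∣
      (∑ k ∈ Finset.range n,
        qint (4 * k + 1) * (qp RatFunc.X (RatFunc.X ^ 2) k) ^ 6 /
          (qp (RatFunc.X ^ 2) (RatFunc.X ^ 2) k) ^ 6 * RatFunc.X ^ k).num := by
  rw [qnat, ← prod_cyclotomic_eq_geom_sum hn]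
  refine Finset.prod_dvd_of_coprime
    (fun i _ j _ hij => cyclotomic.isCoprime_rat hij) fun d hd => ?_
  obtain ⟨hd1, hdn⟩ := mem_erase.1 hd
  obtain ⟨e, rfl⟩ := Nat.dvd_of_mem_divisors hdn
  obtain ⟨m, rfl⟩ := (Nat.odd_mul.1 hodd).1
  have hz := Complex.isPrimitiveRoot_exp (2 * m + 1) (by omega)
  rw [cyclotomic_eq_minpoly_rat hz (by omega)]
  apply minpoly.dvd
  rw [mul_comm _ e]
  exact (hasValueAt_sum_zero (by omega) hz e).aeval_num_eq_zero
end

section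
/- Let n be a positive integer coprime with 6 and let M = n-1 or M = (n-1)/2 (when n is odd). Then sum_{k=0}^{M} [8k+1] * (q;q^2)_k^2 (q;q^2)_{2k} (q^{-3};q^6)_k / ((q^2;q^2)_{2k} (q^6;q^6)_k (q^{-3};q^2)_k (q^6;q^2)_k) * q^{2k} ≡ 0 (mod [n]^2); i.e., the numerator of the reduced rational function is divisible by [n]^2 in Z[q]. -/
open Finset Polynomial

section ClosedForm

variable {F : Type*} [Field F]

lemma qp_succ (a q : F) (k : ℕ) : qp a q (k + 1) = qp a q k * (1 - a * q ^ k) :=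
  Finset.prod_range_succ _ _

lemma qp_succ' (a q : F) (k : ℕ) : qp a q (k + 1) = (1 - a) * qp (a * q) q k := by
  simp only [qp, Finset.prod_range_succ', pow_zero, mul_one]
  rw [mul_comm]
  congr 1
  exact Finset.prod_congr rfl fun j _ => by ring

lemma qp_pow_pow (q : F) (c d k : ℕ) :
    qp (q ^ c) (q ^ d) k = ∏ j ∈ Finset.range k, (1 - q ^ (d * j + c)) :=
  Finset.prod_congr rfl fun j _ => by rw [← pow_mul, ← pow_add, add_comm]

lemma qp_pow_pow_ne_zero {q : F} (hq : ∀ m : ℕ, 0 < m → 1 - q ^ m ≠ 0) {c : ℕ} (hc : 0 < c)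
    (d k : ℕ) : qp (q ^ c) (q ^ d) k ≠ 0 := by
  rw [qp_pow_pow]
  exact Finset.prod_ne_zero_iff.2 fun j _ => hq _ (by omega)

/-- The numerator of the closed form of the partial sums `∑_{k ≤ N}`. -/
noncomputable def closedNum (q : F) (N : ℕ) : F :=
  qp (q ^ 1) (q ^ 2) (2 * N + 2) * qp (q ^ 1) (q ^ 2) (N + 1) * qp (q ^ 3) (q ^ 6) N *
    ((1 - q ^ 2) * (1 - q ^ 4))

/-- The denominator of the closed form of the partial sums. -/
noncomputable def closedDen (q : F) (N : ℕ) : F :=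
  (1 - q ^ 1) ^ 2 * (1 - q ^ 3) * (1 - q ^ (2 * N + 2)) * (1 - q ^ (2 * N + 4)) *
    (qp (q ^ 2) (q ^ 2) (2 * N) * qp (q ^ 6) (q ^ 6) N * qp (q ^ 2) (q ^ 2) N)

/-- The summand, with `[8k+1]` written as a quotient. -/
noncomputable def summand (q : F) (k : ℕ) : F :=
  (1 - q ^ (8 * k + 1)) / (1 - q) * (qp q (q ^ 2) k) ^ 2 * qp q (q ^ 2) (2 * k) *
      qp (q ^ (-3 : ℤ)) (q ^ 6) k /
    (qp (q ^ 2) (q ^ 2) (2 * k) * qp (q ^ 6) (q ^ 6) k *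
      qp (q ^ (-3 : ℤ)) (q ^ 2) k * qp (q ^ 6) (q ^ 2) k) * q ^ (2 * k)

lemma closedForm_add_summand {q : F} (hq0 : q ≠ 0) (hq : ∀ m : ℕ, 0 < m → 1 - q ^ m ≠ 0) (N : ℕ) :
    closedNum q N / closedDen q N + summand q (N + 1) =
      closedNum q (N + 1) / closedDen q (N + 1) := by
  have hneg6 : qp (q ^ (-3 : ℤ)) (q ^ 6) (N + 1) = (1 - q ^ (-3 : ℤ)) * qp (q ^ 3) (q ^ 6) N := by
    rw [qp_succ']
    congr 2
    rw [← zpow_natCast q 6, ← zpow_add₀ hq0]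
    norm_num
  have hq3 : 1 - q ^ (-3 : ℤ) = -(1 - q ^ 3) / q ^ 3 := by
    rw [zpow_neg, show q ^ (3 : ℤ) = q ^ 3 from by exact_mod_cast zpow_natCast q 3]
    field_simp
    ring
  have hneg2 : qp (q ^ (-3 : ℤ)) (q ^ 2) (N + 1) * (q - (q ^ N) ^ 2) =
      (1 - q ^ (-3 : ℤ)) * (q - 1) * qp q (q ^ 2) N := by
    have h := qp_succ (q ^ (-3 : ℤ)) (q ^ 2) (N + 1)
    have e1 : q ^ (-3 : ℤ) * q ^ 2 = q⁻¹ := by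
      rw [← zpow_natCast q 2, ← zpow_add₀ hq0]; norm_num
    have e2 : q⁻¹ * q ^ 2 = q := by field_simp
    rw [qp_succ', e1, qp_succ', e2, pow_succ (q ^ 2) N, mul_comm ((q ^ 2) ^ N),
      ← mul_assoc (q ^ (-3 : ℤ)), e1, pow_right_comm] at h
    have e3 : q - (q ^ N) ^ 2 = q * (1 - q⁻¹ * (q ^ N) ^ 2) := by field_simp
    have e4 : q - 1 = q * (1 - q⁻¹) := by field_simp
    rw [e3, e4]
    linear_combination (-q) * h
  have h6 : (1 - q ^ 2) * (1 - q ^ 4) * qp (q ^ 6) (q ^ 2) (N + 1) = qp (q ^ 2) (q ^ 2) (N + 3) := by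
    rw [show N + 3 = N + 1 + 1 + 1 from rfl, qp_succ' _ _ (N + 1 + 1), qp_succ' _ _ (N + 1),
      ← pow_add, ← pow_add, mul_assoc]
  have hs : q - (q ^ N) ^ 2 ≠ 0 := by
    rcases N with _ | N
    · have := hq 1 one_pos
      intro h
      exact this (by linear_combination -h)
    · have e : q - (q ^ (N + 1)) ^ 2 = q * (1 - q ^ (2 * N + 1)) := by ring
      rw [e]
      exact mul_ne_zero hq0 (hq _ (by omega))
  have g2 := eq_div_of_mul_eq hs hneg2
  have g6 := eq_div_of_mul_eq (mul_ne_zero (hq 2 (by norm_num)) (hq 4 (by norm_num)))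
    ((mul_comm _ _).trans h6)
  have ha : qp q (q ^ 2) N ≠ 0 := by simpa using qp_pow_pow_ne_zero hq one_pos 2 N
  have hd := qp_pow_pow_ne_zero hq two_pos 2 (2 * N)
  have he := qp_pow_pow_ne_zero hq (c := 6) (by norm_num) 6 N
  have hg := qp_pow_pow_ne_zero hq two_pos 2 N
  have n1 : 1 - q ≠ 0 := by simpa using hq 1 one_pos
  have n3 := hq 3 (by norm_num)
  have n2 := hq 2 (by norm_num)
  have n4 := hq 4 (by norm_num)
  have m1 := hq (2 * N + 2) (by omega)
  have m2 := hq (2 * N + 4) (by omega)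
  have m3 := hq (2 * N + 6) (by omega)
  have m4 := hq (4 * N + 2) (by omega)
  have m5 := hq (4 * N + 4) (by omega)
  have m6 := hq (6 * N + 6) (by omega)
  rw [summand, closedNum, closedNum, closedDen, closedDen, g2, g6, hneg6, hq3]
  rw [show 2 * (N + 1) + 2 = 2 * N + 1 + 1 + 1 + 1 by ring, show 2 * N + 2 = 2 * N + 1 + 1 by ring,
    show 2 * (N + 1) = 2 * N + 1 + 1 by ring]
  simp only [qp_succ, pow_one]
  generalize qp q (q ^ 2) N = a at *
  generalize qp q (q ^ 2) (2 * N) = b at *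
  generalize qp (q ^ 3) (q ^ 6) N = c at *
  generalize qp (q ^ 2) (q ^ 2) (2 * N) = d at *
  generalize qp (q ^ 6) (q ^ 6) N = e at *
  generalize qp (q ^ 2) (q ^ 2) N = g at *
  clear g2 g6 h6 hneg2 hneg6 hq3 hq
  have p : ∀ i j : ℕ, q ^ (i * N + j) = (q ^ N) ^ i * q ^ j := fun i j => by
    rw [pow_add, mul_comm i, pow_mul]
  have p0 : (q ^ 2) ^ N = (q ^ N) ^ 2 := pow_right_comm ..
  have p1 : (q ^ 2) ^ (2 * N) = (q ^ N) ^ 4 := by ring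
  have p2 : (q ^ 2) ^ (2 * N + 1) = (q ^ N) ^ 4 * q ^ 2 := by ring
  have p3 : (q ^ 2) ^ (2 * N + 1 + 1) = (q ^ N) ^ 4 * q ^ 4 := by ring
  have p4 : (q ^ 2) ^ (2 * N + 1 + 1 + 1) = (q ^ N) ^ 4 * q ^ 6 := by ring
  have p5 : (q ^ 2) ^ (N + 1) = (q ^ N) ^ 2 * q ^ 2 := by ring
  have p6 : (q ^ 2) ^ (N + 1 + 1) = (q ^ N) ^ 2 * q ^ 4 := by ring
  have p7 : (q ^ 6) ^ N = (q ^ N) ^ 6 := pow_right_comm ..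
  have p8 : q ^ (2 * N + 1 + 1) = (q ^ N) ^ 2 * q ^ 2 := by ring
  have p9 : q ^ (2 * N + 1 + 1 + 1 + 1) = (q ^ N) ^ 2 * q ^ 4 := by ring
  have p10 : q ^ (2 * N + 1 + 1 + 4) = (q ^ N) ^ 2 * q ^ 6 := by ring
  have p11 : q ^ (8 * (N + 1) + 1) = (q ^ N) ^ 8 * q ^ 9 := by ring
  simp only [p] at m1 m2 m3 m4 m5 m6
  simp only [p0, p1, p2, p3, p4, p5, p6, p7, p8, p9, p10, p11]
  clear p p0 p1 p2 p3 p4 p5 p6 p7 p8 p9 p10 p11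
  generalize q ^ N = x at *
  rw [show q ^ 2 * (x ^ 4 * q ^ 2) = x ^ 4 * q ^ 4 by ring, mul_comm (q ^ 2) (x ^ 4),
    mul_comm (q ^ 6) (x ^ 6), mul_comm (q ^ 2) (x ^ 2),
    show q ^ 2 * (x ^ 2 * q ^ 2) = x ^ 2 * q ^ 4 by ring,
    show q ^ 2 * (x ^ 2 * q ^ 4) = x ^ 2 * q ^ 6 by ring]
  have key : (1 - x ^ 4 * q ^ 2) * (1 - x ^ 4 * q ^ 4) * (1 - x ^ 6 * q ^ 6) * (1 - x ^ 2 * q ^ 6) -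
      (1 - q ^ 3) * (1 - x ^ 8 * q ^ 9) * (1 - q * x ^ 2) * (q - x ^ 2) * (x ^ 2 * q ^ 2) =
      (1 - q * (x ^ 4 * q ^ 4)) * (1 - q * (x ^ 4 * q ^ 6)) * (1 - q * (x ^ 2 * q ^ 2)) *
        (1 - q ^ 3 * x ^ 6) := by ring
  rw [show q - 1 = -(1 - q) by ring]
  have hq3 : q ^ 3 ≠ 0 := pow_ne_zero _ hq0
  generalize x ^ 2 * q ^ 2 = w at *
  generalize 1 - x ^ 2 * q ^ 4 = y2 at *
  generalize 1 - x ^ 2 * q ^ 6 = y3 at *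
  generalize 1 - x ^ 4 * q ^ 2 = y4 at *
  generalize 1 - x ^ 4 * q ^ 4 = y5 at *
  generalize 1 - x ^ 6 * q ^ 6 = y6 at *
  generalize 1 - x ^ 8 * q ^ 9 = z1 at *
  generalize 1 - q * (x ^ 4 * q ^ 4) = z2 at *
  generalize 1 - q * (x ^ 4 * q ^ 6) = z3 at *
  generalize 1 - q * w = z4 at *
  generalize 1 - q ^ 3 * x ^ 6 = z5 at *
  generalize 1 - q * x ^ 4 = z6 at *
  generalize 1 - q * (x ^ 4 * q ^ 2) = z7 at *
  generalize 1 - q * x ^ 2 = z8 at *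
  generalize q - x ^ 2 = z9 at *
  generalize 1 - q ^ 2 = s2 at *
  generalize 1 - q ^ 3 = s3 at *
  generalize 1 - q ^ 4 = s4 at *
  generalize 1 - q = s1 at *
  generalize 1 - w = y1 at *
  generalize q ^ 3 = r at *
  field_simp
  linear_combination b * z6 * z7 * z8 * c * key

lemma sum_summand {q : F} (hq0 : q ≠ 0) (hq : ∀ m : ℕ, 0 < m → 1 - q ^ m ≠ 0) (N : ℕ) :
    ∑ k ∈ Finset.range (N + 1), summand q k = closedNum q N / closedDen q N := by
  induction N with
  | zero =>
    have n1 : 1 - q ≠ 0 := by simpa using hq 1 one_pos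
    have n2 := hq 2 (by norm_num)
    have n3 := hq 3 (by norm_num)
    have n4 := hq 4 (by norm_num)
    simp [summand, closedNum, closedDen, qp, Finset.prod_range_succ, ← pow_succ']
    field_simp
  | succ N ih => rw [Finset.sum_range_succ, ih, closedForm_add_summand hq0 hq]

end ClosedForm

section Valuation

lemma cyclotomic_prime {d : ℕ} (hd : 0 < d) : Prime (cyclotomic d ℚ) :=
  (cyclotomic.irreducible_rat hd).prime

lemma one_sub_X_pow_ne_zero_s12 {m : ℕ} (hm : 0 < m) : (1 - X ^ m : ℚ[X]) ≠ 0 := by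
  rw [← neg_sub, neg_ne_zero]
  exact X_pow_sub_C_ne_zero hm 1

lemma cyclotomic_dvd_one_sub_X_pow_iff {d m : ℕ} (hd : 0 < d) (hm : 0 < m) :
    cyclotomic d ℚ ∣ 1 - X ^ m ↔ d ∣ m := by
  rw [← neg_sub, dvd_neg, ← prod_cyclotomic_eq_X_pow_sub_one hm]
  constructor
  · intro h
    obtain ⟨i, hi, hdi⟩ := (cyclotomic_prime hd).exists_mem_finset_dvd h
    by_contra hdm
    have hne : d ≠ i := by
      rintro rfl
      exact hdm (Nat.dvd_of_mem_divisors hi)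
    exact (cyclotomic_prime hd).not_isUnit
      ((cyclotomic.isCoprime_rat hne).isUnit_of_dvd' dvd_rfl hdi)
  · intro h
    exact Finset.dvd_prod_of_mem _ (Nat.mem_divisors.2 ⟨h, hm.ne'⟩)

lemma emultiplicity_cyclotomic_one_sub_X_pow {d m : ℕ} (hd : 0 < d) (hm : 0 < m) :
    emultiplicity (cyclotomic d ℚ) (1 - X ^ m) = ((if d ∣ m then 1 else 0 : ℕ) : ℕ∞) := by
  split_ifs with h
  · have hsq : Squarefree (1 - X ^ m : ℚ[X]) := by
      refine Squarefree.squarefree_of_dvd (y := X ^ m - 1) ?_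
        (X_pow_sub_one_separable_iff.2 (by exact_mod_cast hm.ne')).squarefree
      rw [← neg_sub, neg_dvd]
    have := squarefree_iff_emultiplicity_le_one _ |>.1 hsq (cyclotomic d ℚ)
    refine le_antisymm (this.resolve_right (cyclotomic_prime hd).not_isUnit) ?_
    exact le_emultiplicity_of_pow_dvd
      (by simpa using (cyclotomic_dvd_one_sub_X_pow_iff hd hm).2 h)
  · rw [emultiplicity_eq_zero.2 (mt (cyclotomic_dvd_one_sub_X_pow_iff hd hm).1 h), Nat.cast_zero]

lemma emultiplicity_cyclotomic_prod {d : ℕ} (hd : 0 < d) (a : ℕ → ℕ) (ha : ∀ j, 0 < a j) (k : ℕ) :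
    emultiplicity (cyclotomic d ℚ) (∏ j ∈ Finset.range k, (1 - X ^ a j)) =
      ((∑ j ∈ Finset.range k, if d ∣ a j then 1 else 0 : ℕ) : ℕ∞) := by
  rw [Finset.emultiplicity_prod (cyclotomic_prime hd), Nat.cast_sum]
  exact Finset.sum_congr rfl fun j _ => emultiplicity_cyclotomic_one_sub_X_pow hd (ha j)

lemma sum_dvd_succ (d k : ℕ) :
    (∑ j ∈ Finset.range k, if d ∣ j + 1 then 1 else 0) = k / d := by
  induction k with
  | zero => simp
  | succ k ih => rw [Finset.sum_range_succ, ih, Nat.succ_div]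

lemma sum_dvd_two_mul_add_one {d : ℕ} (hd : d.Coprime 2) (k : ℕ) :
    (∑ j ∈ Finset.range k, if d ∣ 2 * j + 1 then 1 else 0) + k / d = 2 * k / d := by
  induction k with
  | zero => simp
  | succ k ih =>
    have h : d ∣ 2 * k + 1 + 1 ↔ d ∣ k + 1 := by
      rw [show 2 * k + 1 + 1 = 2 * (k + 1) by ring, hd.dvd_mul_left]
    rw [Finset.sum_range_succ, show 2 * (k + 1) = 2 * k + 1 + 1 by ring, Nat.succ_div,
      Nat.succ_div, Nat.succ_div, ← ih]
    simp only [h]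
    ring

/-- `closedNum` at the indeterminate, as a polynomial. -/
noncomputable def polyNum (N : ℕ) : ℚ[X] :=
  (∏ j ∈ Finset.range (2 * N + 2), (1 - X ^ (2 * j + 1))) *
    (∏ j ∈ Finset.range (N + 1), (1 - X ^ (2 * j + 1))) *
    (∏ j ∈ Finset.range N, (1 - X ^ (6 * j + 3))) * ((1 - X ^ 2) * (1 - X ^ 4))

/-- `closedDen` at the indeterminate, as a polynomial. -/
noncomputable def polyDen (N : ℕ) : ℚ[X] :=
  (1 - X ^ 1) ^ 2 * (1 - X ^ 3) * (1 - X ^ (2 * N + 2)) * (1 - X ^ (2 * N + 4)) *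
    ((∏ j ∈ Finset.range (2 * N), (1 - X ^ (2 * j + 2))) *
      (∏ j ∈ Finset.range N, (1 - X ^ (6 * j + 6))) *
      (∏ j ∈ Finset.range N, (1 - X ^ (2 * j + 2))))

lemma algebraMap_polyNum (N : ℕ) :
    algebraMap ℚ[X] (RatFunc ℚ) (polyNum N) = closedNum RatFunc.X N := by
  simp only [polyNum, closedNum, qp_pow_pow, map_mul, map_prod, map_sub, map_one, map_pow,
    RatFunc.algebraMap_X]

lemma algebraMap_polyDen (N : ℕ) :
    algebraMap ℚ[X] (RatFunc ℚ) (polyDen N) = closedDen RatFunc.X N := by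
  simp only [polyDen, closedDen, qp_pow_pow, map_mul, map_prod, map_sub, map_one, map_pow,
    RatFunc.algebraMap_X]

lemma polyDen_ne_zero (N : ℕ) : polyDen N ≠ 0 := by
  simp only [polyDen, mul_ne_zero_iff, Finset.prod_ne_zero_iff]
  refine ⟨⟨⟨⟨pow_ne_zero _ ?_, ?_⟩, ?_⟩, ?_⟩, ⟨fun j _ => ?_, fun j _ => ?_⟩, fun j _ => ?_⟩ <;>
    exact one_sub_X_pow_ne_zero_s12 (by omega)

lemma le_emultiplicity_polyNum {d : ℕ} (hd : 0 < d) (h2 : d.Coprime 2) (h3 : d.Coprime 3) (N : ℕ) :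
    ((2 * (2 * N + 2) / d - (2 * N + 2) / d + (2 * (N + 1) / d - (N + 1) / d) +
      (2 * N / d - N / d) : ℕ) : ℕ∞) ≤ emultiplicity (cyclotomic d ℚ) (polyNum N) := by
  have h6 : ∀ j, d ∣ 6 * j + 3 ↔ d ∣ 2 * j + 1 := fun j => by
    rw [show 6 * j + 3 = 3 * (2 * j + 1) by ring, h3.dvd_mul_left]
  have hsum := fun k => Nat.eq_sub_of_add_eq (sum_dvd_two_mul_add_one h2 k)
  have hp := cyclotomic_prime hd
  rw [polyNum, emultiplicity_mul hp, emultiplicity_mul hp, emultiplicity_mul hp,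
    emultiplicity_cyclotomic_prod hd _ (by omega), emultiplicity_cyclotomic_prod hd _ (by omega),
    emultiplicity_cyclotomic_prod hd _ (by omega)]
  simp only [h6, hsum, Nat.cast_add]
  exact le_self_add

lemma emultiplicity_polyDen {d : ℕ} (hd : 1 < d) (h2 : d.Coprime 2) (h3 : d.Coprime 3) (N : ℕ) :
    emultiplicity (cyclotomic d ℚ) (polyDen N) =
      (((if d ∣ N + 1 then 1 else 0) + (if d ∣ N + 2 then 1 else 0) +
        (2 * N / d + N / d + N / d) : ℕ) : ℕ∞) := by
  have h2' : ∀ j, d ∣ 2 * j + 2 ↔ d ∣ j + 1 := fun j => by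
    rw [show 2 * j + 2 = 2 * (j + 1) by ring, h2.dvd_mul_left]
  have h4 : d ∣ 2 * N + 4 ↔ d ∣ N + 2 := by
    rw [show 2 * N + 4 = 2 * (N + 2) by ring, h2.dvd_mul_left]
  have h6 : ∀ j, d ∣ 6 * j + 6 ↔ d ∣ j + 1 := fun j => by
    rw [show 6 * j + 6 = 3 * (2 * j + 2) by ring, h3.dvd_mul_left, h2']
  have hd1 : ¬ d ∣ 1 := fun h => hd.ne' (Nat.dvd_one.1 h)
  have hd3 : ¬ d ∣ 3 := fun h => hd.ne' (h3.eq_one_of_dvd h)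
  have hd0 : 0 < d := by omega
  have hp := cyclotomic_prime hd0
  rw [polyDen]
  simp only [emultiplicity_mul hp, emultiplicity_pow hp]
  rw [emultiplicity_cyclotomic_prod hd0 _ (by omega), emultiplicity_cyclotomic_prod hd0 _ (by omega),
    emultiplicity_cyclotomic_prod hd0 _ (by omega),
    emultiplicity_cyclotomic_one_sub_X_pow hd0 (by omega),
    emultiplicity_cyclotomic_one_sub_X_pow hd0 (by omega),
    emultiplicity_cyclotomic_one_sub_X_pow hd0 (by omega),
    emultiplicity_cyclotomic_one_sub_X_pow hd0 (by omega)]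
  simp only [h2', h4, h6, sum_dvd_succ, hd1, hd3, if_false, Nat.cast_add, Nat.cast_zero, mul_zero,
    zero_add]

/-- A factor `p ^ e` by which the numerator of a fraction beats its denominator
divides the numerator of the reduced fraction. -/
lemma pow_dvd_num_of_emultiplicity {K : Type*} [Field K] {p A B : K[X]} (hp : Prime p) (hB : B ≠ 0)
    {e : ℕ} (h : emultiplicity p B + e ≤ emultiplicity p A) {S : RatFunc K}
    (hS : S = algebraMap K[X] (RatFunc K) A / algebraMap K[X] (RatFunc K) B) :
    p ^ e ∣ S.num := by
  have hmul : S.num * B = A * S.denom := by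
    have hB' := RatFunc.algebraMap_ne_zero hB
    have hD' := RatFunc.algebraMap_ne_zero S.denom_ne_zero
    apply RatFunc.algebraMap_injective K
    rw [map_mul, map_mul, ← div_eq_div_iff hD' hB', S.num_div_denom, hS]
  have hm := congrArg (emultiplicity p) hmul
  rw [emultiplicity_mul hp, emultiplicity_mul hp] at hm
  have hfin : emultiplicity p B ≠ ⊤ :=
    finiteMultiplicity_iff_emultiplicity_ne_top.1 (FiniteMultiplicity.of_prime_left hp hB)
  rw [pow_dvd_iff_le_emultiplicity]
  have : emultiplicity p B + e ≤ emultiplicity p B + emultiplicity p S.num := by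
    rw [add_comm _ (emultiplicity p S.num), hm]
    exact h.trans le_self_add
  exact (ENat.add_le_add_iff_left hfin).1 this

end Valuation

lemma one_sub_ratFuncX_pow_ne_zero {m : ℕ} (hm : 0 < m) : (1 - RatFunc.X ^ m : RatFunc ℚ) ≠ 0 := by
  simpa using RatFunc.algebraMap_ne_zero (one_sub_X_pow_ne_zero_s12 hm)

lemma qint_eq_div (m : ℕ) : qint m = (1 - RatFunc.X ^ m) / (1 - RatFunc.X) := by
  have h : (1 - RatFunc.X : RatFunc ℚ) ≠ 0 := by simpa using one_sub_ratFuncX_pow_ne_zero one_pos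
  rw [eq_div_iff h, qint, geom_sum_mul_neg]

lemma qnat_sq_dvd_of_cyclotomic {n : ℕ} (hn : 0 < n) {P : ℚ[X]}
    (h : ∀ d, d ∣ n → 1 < d → cyclotomic d ℚ ^ 2 ∣ P) : qnat n ^ 2 ∣ P := by
  rw [qnat, ← prod_cyclotomic_eq_geom_sum hn, ← Finset.prod_pow]
  refine Finset.prod_dvd_of_coprime (fun i _ j _ hij => (cyclotomic.isCoprime_rat hij).pow) ?_
  intro d hd
  rw [Finset.mem_erase, Nat.mem_divisors] at hd
  exact h d hd.2.1 (by have := Nat.pos_of_dvd_of_pos hd.2.1 hn; omega)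

lemma qnat_sq_dvd_num_sum {n N : ℕ} (hn : 0 < n) (hcop : n.Coprime 6)
    (hN : ∀ d, d ∣ n → 1 < d → d.Coprime 2 → d.Coprime 3 →
      (if d ∣ N + 1 then 1 else 0) + (if d ∣ N + 2 then 1 else 0) +
        (2 * N / d + N / d + N / d) + 2 ≤
      2 * (2 * N + 2) / d - (2 * N + 2) / d + (2 * (N + 1) / d - (N + 1) / d) +
        (2 * N / d - N / d)) :
    qnat n ^ 2 ∣ (∑ k ∈ Finset.range (N + 1), summand (RatFunc.X : RatFunc ℚ) k).num := by
  refine qnat_sq_dvd_of_cyclotomic hn fun d hdn hd => ?_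
  have h6 := hcop.coprime_dvd_left hdn
  have h2 : d.Coprime 2 := h6.coprime_dvd_right (by norm_num)
  have h3 : d.Coprime 3 := h6.coprime_dvd_right (by norm_num)
  refine pow_dvd_num_of_emultiplicity (cyclotomic_prime (by omega)) (polyDen_ne_zero N) ?_
    (by rw [algebraMap_polyNum, algebraMap_polyDen,
      sum_summand RatFunc.X_ne_zero fun m => one_sub_ratFuncX_pow_ne_zero])
  refine le_trans ?_ (le_emultiplicity_polyNum (by omega) h2 h3 N)
  rw [emultiplicity_polyDen hd h2 h3]
  exact_mod_cast hN d hdn hd h2 h3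

/-- the truncated sums (at `M = n-1` and `M = (n-1)/2`) are
congruent to 0 modulo `[n]^2` when `gcd(n,6) = 1`. -/
theorem stmt12 (n : ℕ) (hn : 0 < n) (hcop : Nat.Coprime n 6) :
    letI q : RatFunc ℚ := RatFunc.X
    letI t : ℕ → RatFunc ℚ := fun k =>
      qint (8 * k + 1) * (qp q (q ^ 2) k) ^ 2 * qp q (q ^ 2) (2 * k) *
          qp (q ^ (-3 : ℤ)) (q ^ 6) k /
        (qp (q ^ 2) (q ^ 2) (2 * k) * qp (q ^ 6) (q ^ 6) k *
          qp (q ^ (-3 : ℤ)) (q ^ 2) k * qp (q ^ 6) (q ^ 2) k) * q ^ (2 * k)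
    ((qnat n) ^ 2 ∣ (∑ k ∈ Finset.range n, t k).num) ∧
    ((qnat n) ^ 2 ∣ (∑ k ∈ Finset.range ((n - 1) / 2 + 1), t k).num) := by
  have ht : ∀ k, summand (RatFunc.X : RatFunc ℚ) k = _ := fun k => by
    rw [summand, ← qint_eq_div]
  simp only [← ht]
  have hdiv : ∀ {d a b r : ℕ}, a = d * b + r → r < d → a / d = b := fun {d a b r} h hr => by
    rw [h, Nat.mul_add_div (by omega), Nat.div_eq_of_lt hr, add_zero]
  constructor
  · obtain ⟨N, rfl⟩ : ∃ N, n = N + 1 := ⟨n - 1, by omega⟩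
    refine qnat_sq_dvd_num_sum hn hcop fun d ⟨m, hm⟩ hd h2 h3 => ?_
    obtain ⟨r, rfl⟩ : ∃ r, m = r + 1 := ⟨m - 1, by rcases m with _ | m <;> simp_all⟩
    have hd2 : d ≠ 2 := by rintro rfl; simp at h2
    have i1 : ¬ d ∣ N + 2 := fun h => hd.ne' <| Nat.dvd_one.1 <|
      (Nat.dvd_add_right ⟨r + 1, hm⟩).1 h
    have i2 : 2 * (2 * N + 2) / d = 4 * (r + 1) := hdiv (r := 0) (by linarith) (by omega)
    have i3 : (2 * N + 2) / d = 2 * (r + 1) := hdiv (r := 0) (by linarith) (by omega)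
    have i4 : 2 * (N + 1) / d = 2 * (r + 1) := hdiv (r := 0) (by linarith) (by omega)
    have i5 : (N + 1) / d = r + 1 := hdiv (r := 0) (by linarith) (by omega)
    have i6 : 2 * N / d = 2 * r + 1 := by
      refine hdiv (r := d - 2) ?_ (by omega)
      zify [hd.le, show 2 ≤ d by omega] at hm ⊢
      linarith
    have i7 : N / d = r := by
      refine hdiv (r := d - 1) ?_ (by omega)
      zify [hd.le] at hm ⊢
      linarith
    rw [i2, i3, i4, i5, i6, i7, if_pos ⟨r + 1, hm⟩, if_neg i1]
    omega
  · refine qnat_sq_dvd_num_sum hn hcop fun d ⟨m, hm⟩ hd h2 h3 => ?_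
    have hn2 : Odd n := Nat.coprime_two_right.1 (hcop.coprime_dvd_right (by norm_num))
    obtain ⟨⟨e, rfl⟩, ⟨r, rfl⟩⟩ := Nat.odd_mul.1 (hm ▸ hn2)
    have he : e ≠ 1 := by rintro rfl; simp at h3
    obtain ⟨N, hN⟩ : ∃ N, N = (n - 1) / 2 := ⟨_, rfl⟩
    have hN' : N = (2 * e + 1) * r + e := by
      have : n = 2 * ((2 * e + 1) * r + e) + 1 := by rw [hm]; ring
      omega
    rw [← hN]
    have i1 : ¬ 2 * e + 1 ∣ N + 1 := by
      rw [hN', add_assoc, Nat.dvd_add_right (dvd_mul_right _ _)]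
      exact Nat.not_dvd_of_pos_of_lt (by omega) (by omega)
    have i2 : ¬ 2 * e + 1 ∣ N + 2 := by
      rw [hN', add_assoc, Nat.dvd_add_right (dvd_mul_right _ _)]
      exact Nat.not_dvd_of_pos_of_lt (by omega) (by omega)
    have i3 : 2 * (2 * N + 2) / (2 * e + 1) = 4 * r + 2 :=
      hdiv (r := 2) (by rw [hN']; ring) (by omega)
    have i4 : (2 * N + 2) / (2 * e + 1) = 2 * r + 1 := hdiv (r := 1) (by rw [hN']; ring) (by omega)
    have i5 : 2 * (N + 1) / (2 * e + 1) = 2 * r + 1 := hdiv (r := 1) (by rw [hN']; ring) (by omega)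
    have i6 : (N + 1) / (2 * e + 1) = r := hdiv (r := e + 1) (by rw [hN']; ring) (by omega)
    have i7 : 2 * N / (2 * e + 1) = 2 * r := hdiv (r := 2 * e) (by rw [hN']; ring) (by omega)
    have i8 : N / (2 * e + 1) = r := hdiv (r := e) hN' (by omega)
    rw [i3, i4, i5, i6, i7, i8, if_neg i1, if_neg i2]
    omega
end
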